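/- arXiv:2308.02991 — 8 statements merged into one kernel-verified Lean document; each statement's English description precedes it below -/
import Mathlib

section
/- For every k ∈ ℕ, every g ∈ G and every control sequence u : ℕ → U, the solution of a discrete-time linear control system satisfies φ(k, g, u) = φ(k, e, u) · f₀ᵏ(g), where f₀ᵏ denotes the k-th iterate of the automorphism f₀. -/
/-- The solution of a discrete-time linear control system:
`phi f₀ b 0 x u = x`, `phi f₀ b (k+1) x u = b (u k) * f₀ (phi f₀ b k x u)`. -/
def phi {G : Type*} [Group G] {U : Type*} (f₀ : G ≃* G) (b : U → G) :
    ℕ → G → (ℕ → U) → G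
  | 0, x, _ => x
  | k + 1, x, u => b (u k) * f₀ (phi f₀ b k x u)

/-- φ(k, g, u) = φ(k, e, u) · f₀ᵏ(g). -/
theorem solution_translation {G : Type*} [Group G] {U : Type*} [Zero U]
    (f₀ : G ≃* G) (b : U → G) (hb : b 0 = 1) :
    ∀ (k : ℕ) (g : G) (u : ℕ → U),
      phi f₀ b k g u = phi f₀ b k 1 u * (⇑f₀)^[k] g := by
  intro k g u
  induction k with
  | zero => simp [phi]
  | succ k ih =>
    rw [phi, phi, ih, map_mul, Function.iterate_succ_apply', mul_assoc]
end

section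
/- For every τ ∈ ℕ and every g ∈ G, the reachable set from g at time τ is the right translate of the reachable set from the identity: R_τ(g) = {x · f₀^τ(g) : x ∈ R_τ}, where f₀^τ is the τ-th iterate of the automorphism f₀. -/
open Pointwise

/-- The reachable set from `x` at time `k`. -/
def reach {G : Type*} [Group G] {U : Type*} (f₀ : G ≃* G) (b : U → G)
    (k : ℕ) (x : G) : Set G :=
  {y | ∃ u : ℕ → U, phi f₀ b k x u = y}

/-- The solution from `g` is the solution from the identity, right translated by `f₀^k g`. -/
theorem phi_eq_phi_one_mul {G : Type*} [Group G] {U : Type*} (f₀ : G ≃* G) (b : U → G)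
    (k : ℕ) (g : G) (u : ℕ → U) :
    phi f₀ b k g u = phi f₀ b k 1 u * (⇑f₀)^[k] g := by
  induction k with
  | zero => simp [phi]
  | succ k ih => rw [phi, phi, ih, map_mul, Function.iterate_succ_apply', mul_assoc]

/-- R_τ(g) = R_τ · f₀^τ(g). -/
theorem reach_from_eq_translate {G : Type*} [Group G] {U : Type*} [Zero U]
    (f₀ : G ≃* G) (b : U → G) (hb : b 0 = 1) (τ : ℕ) (g : G) :
    reach f₀ b τ g = {y : G | ∃ x ∈ reach f₀ b τ 1, y = x * (⇑f₀)^[τ] g} := by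
  ext y
  simp [reach, phi_eq_phi_one_mul f₀ b τ g, eq_comm]
end

section
/- For all τ₁, τ₂ ∈ ℕ, the reachable sets from the identity satisfy the concatenation identities R_{τ₁+τ₂} = R_{τ₁} · f₀^{τ₁}(R_{τ₂}) = R_{τ₂} · f₀^{τ₂}(R_{τ₁}), where the products are setwise products in G and f₀^τ(A) denotes the image of the set A under the τ-th iterate of f₀. -/
open Pointwise

theorem phi_congr {G : Type*} [Group G] {U : Type*} (f₀ : G ≃* G) (b : U → G) (x : G)
    {u v : ℕ → U} {k : ℕ} (h : ∀ i < k, u i = v i) : phi f₀ b k x u = phi f₀ b k x v := by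
  induction k with
  | zero => rfl
  | succ k ih =>
    simp only [phi]
    rw [h k k.lt_succ_self, ih fun i hi => h i (hi.trans k.lt_succ_self)]

theorem phi_add {G : Type*} [Group G] {U : Type*} (f₀ : G ≃* G) (b : U → G) (s t : ℕ)
    (x : G) (u : ℕ → U) :
    phi f₀ b (s + t) x u =
      phi f₀ b s 1 (fun i => u (i + t)) * (⇑f₀)^[s] (phi f₀ b t x u) := by
  induction s with
  | zero => simp [phi]
  | succ s ih =>
    rw [Nat.add_right_comm]
    simp only [phi, ih, map_mul, mul_assoc, Function.iterate_succ_apply']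

theorem reach_add_eq_mul_image {G : Type*} [Group G] {U : Type*} (f₀ : G ≃* G) (b : U → G)
    (s t : ℕ) (x : G) :
    reach f₀ b (s + t) x = reach f₀ b s 1 * (⇑f₀)^[s] '' reach f₀ b t x := by
  ext y
  constructor
  · rintro ⟨u, rfl⟩
    rw [phi_add]
    exact Set.mul_mem_mul ⟨_, rfl⟩ ⟨_, ⟨u, rfl⟩, rfl⟩
  · rintro ⟨_, ⟨v, rfl⟩, _, ⟨_, ⟨w, rfl⟩, rfl⟩, rfl⟩
    refine ⟨fun i => if i < t then w i else v (i - t), ?_⟩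
    rw [phi_add, phi_congr f₀ b x (u := fun i => if i < t then w i else v (i - t)) (v := w)
      fun i hi => if_pos hi]
    simp

/-- R_{τ₁+τ₂} = R_{τ₁} · f₀^{τ₁}(R_{τ₂}) = R_{τ₂} · f₀^{τ₂}(R_{τ₁}). -/
theorem reach_add {G : Type*} [Group G] {U : Type*} [Zero U]
    (f₀ : G ≃* G) (b : U → G) (hb : b 0 = 1) (τ₁ τ₂ : ℕ) :
    reach f₀ b (τ₁ + τ₂) 1 = reach f₀ b τ₁ 1 * (⇑f₀)^[τ₁] '' reach f₀ b τ₂ 1 ∧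
    reach f₀ b (τ₁ + τ₂) 1 = reach f₀ b τ₂ 1 * (⇑f₀)^[τ₂] '' reach f₀ b τ₁ 1 :=
  ⟨reach_add_eq_mul_image f₀ b τ₁ τ₂ 1,
    Nat.add_comm τ₁ τ₂ ▸ reach_add_eq_mul_image f₀ b τ₂ τ₁ 1⟩
end

section
/- For every k ≥ 1, the reachable set at time k of the conjugate system satisfies R^C_k = R_1 · (w R_1 w⁻¹) · (w² R_1 w⁻²) ⋯ (w^{k-1} R_1 w^{-(k-1)}), an ordered setwise product in G, where R_1 = {b(u) : u ∈ U} is the time-one reachable set (which is the same for both systems). -/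
open Pointwise

theorem reach_zero {G : Type*} [Group G] {U : Type*} [Nonempty U] (f₀ : G ≃* G) (b : U → G)
    (x : G) : reach f₀ b 0 x = {x} := by
  ext y
  simp [reach, phi, eq_comm]

theorem reach_succ {G : Type*} [Group G] {U : Type*} (f₀ : G ≃* G) (b : U → G) (k : ℕ) (x : G) :
    reach f₀ b (k + 1) x = Set.range b * f₀ '' reach f₀ b k x := by
  ext y
  constructor
  · rintro ⟨u, rfl⟩
    exact Set.mul_mem_mul ⟨u k, rfl⟩ ⟨_, ⟨u, rfl⟩, rfl⟩
  · rintro ⟨_, ⟨a, rfl⟩, _, ⟨_, ⟨u, rfl⟩, rfl⟩, rfl⟩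
    refine ⟨Function.update u k a, ?_⟩
    rw [phi, Function.update_self,
      phi_congr f₀ b x fun i hi => Function.update_of_ne (Nat.ne_of_lt hi) a u]

theorem reach_one_eq_prod {G : Type*} [Group G] {U : Type*} [Nonempty U] (f₀ : MulAut G)
    (b : U → G) (k : ℕ) :
    reach f₀ b k 1 = ((List.range k).map fun i => ⇑(f₀ ^ i) '' Set.range b).prod := by
  induction k with
  | zero => simp [reach_zero, Set.singleton_one]
  | succ k ih =>
    rw [reach_succ, ih, List.range_succ_eq_map, List.map_cons, List.prod_cons, List.map_map]
    congr 1
    · simp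
    · rw [Set.image_list_prod, List.map_map]
      congr 1
      refine List.map_congr_left fun i _ => ?_
      simp only [Function.comp_apply, Set.image_image, Nat.succ_eq_add_one, pow_succ']
      rfl

/-- for the conjugate system (automorphism C_w : x ↦ w x w⁻¹),
R^C_k = R₁ · (w R₁ w⁻¹) · (w² R₁ w⁻²) ⋯ (w^{k-1} R₁ w^{-(k-1)}),
where R₁ = {b u : u ∈ U}. -/
theorem conj_system_reach_prod {G : Type*} [Group G] {U : Type*} [Zero U]
    (b : U → G) (hb : b 0 = 1) (w : G) (k : ℕ) (hk : 1 ≤ k) :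
    reach (MulAut.conj w) b k 1 =
      ((List.range k).map fun i =>
        (fun x => w ^ i * x * (w ^ i)⁻¹) '' Set.range b).prod := by
  have : Nonempty U := ⟨0⟩
  rw [reach_one_eq_prod]
  simp only [← map_pow]
  rfl
end

section
/- Fix w ∈ G and define g : G → G by g(x) = w⁻¹ · f₀(x) · w. If g⁻¹(R) ⊆ R, then the reachable set of the conjugate system is contained in the reachable set of the original system: R^C ⊆ R, and moreover R^C_k ⊆ R for every k ≥ 1. -/
open Pointwise

/-- One more step of the system keeps a point inside the reachable set from `x`. -/
theorem mul_map_mem_reach_succ {G : Type*} [Group G] {U : Type*} (f₀ : G ≃* G) (b : U → G)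
    {k : ℕ} {x y : G} (hy : y ∈ reach f₀ b k x) (v : U) :
    b v * f₀ y ∈ reach f₀ b (k + 1) x := by
  obtain ⟨u, rfl⟩ := hy
  have phi_congr : ∀ (n : ℕ) (u u' : ℕ → U), (∀ i < n, u i = u' i) →
      phi f₀ b n x u = phi f₀ b n x u' := by
    intro n u u' h
    induction n with
    | zero => rfl
    | succ n ih => simp only [phi, h n n.lt_succ_self, ih fun i hi => h i (hi.trans n.lt_succ_self)]
  refine ⟨Function.update u k v, ?_⟩
  simp only [phi, Function.update_self]
  rw [phi_congr k _ u fun i hi => Function.update_of_ne hi.ne _ _]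

/-- with g(x) = w⁻¹ f₀(x) w, if g⁻¹(R) ⊆ R then the reachable set of
the conjugate system (automorphism C_w) is contained in R, and R^C_k ⊆ R for all k ≥ 1. -/
theorem conj_system_reach_subset {G : Type*} [Group G] {U : Type*} [Zero U]
    (f₀ : G ≃* G) (b : U → G) (hb : b 0 = 1) (w : G)
    (hg : (fun x => w⁻¹ * f₀ x * w) ⁻¹' (⋃ k ≥ 1, reach f₀ b k 1) ⊆
      ⋃ k ≥ 1, reach f₀ b k 1) :
    (⋃ k ≥ 1, reach (MulAut.conj w) b k 1) ⊆ (⋃ k ≥ 1, reach f₀ b k 1) ∧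
    ∀ k : ℕ, 1 ≤ k → reach (MulAut.conj w) b k 1 ⊆ ⋃ k ≥ 1, reach f₀ b k 1 := by
  have mem_of_phi : ∀ (k : ℕ) (u : ℕ → U),
      phi (MulAut.conj w) b k 1 u ∈ ⋃ k ≥ 1, reach f₀ b k 1 := by
    intro k u
    induction k with
    | zero => exact Set.mem_iUnion₂.2 ⟨1, le_rfl, fun _ => 0, by simp [phi, hb]⟩
    | succ k ih =>
      set y := phi (MulAut.conj w) b k 1 u with hy
      have hx : f₀.symm (w * y * w⁻¹) ∈ ⋃ k ≥ 1, reach f₀ b k 1 :=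
        hg (by simpa [Set.mem_preimage, mul_assoc] using ih)
      obtain ⟨n, -, hn⟩ := Set.mem_iUnion₂.1 hx
      refine Set.mem_iUnion₂.2 ⟨n + 1, Nat.le_add_left 1 n, ?_⟩
      simpa [phi, ← hy] using mul_map_mem_reach_succ f₀ b hn (u k)
  have reach_subset : ∀ k : ℕ, 1 ≤ k →
      reach (MulAut.conj w) b k 1 ⊆ ⋃ k ≥ 1, reach f₀ b k 1 := by
    rintro k - _ ⟨u, rfl⟩
    exact mem_of_phi k u
  exact ⟨Set.iUnion₂_subset reach_subset, reach_subset⟩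
end

section
/- For every k ≥ 1, the reachable set at time k of the reversed system equals the controllable set at time k of the original system, and the controllable set at time k of the reversed system equals the reachable set at time k of the original system: R*_k = C_k and C*_k = R_k. -/
open Pointwise

/-- Running the reversed system for `j ≤ k` steps from the endpoint of a solution, with the controls
in reverse order, retraces the solution. -/
theorem phi_reversed_phi {G : Type*} [Group G] {U : Type*} (f₀ : G ≃* G) (b : U → G)
    (x : G) (u : ℕ → U) (k j : ℕ) (hj : j ≤ k) :
    phi f₀.symm (fun u => f₀.symm (b u)⁻¹) j (phi f₀ b k x u) (fun i => u (k - 1 - i)) =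
      phi f₀ b (k - j) x u := by
  induction j with
  | zero => rfl
  | succ j ih =>
    obtain ⟨m, rfl⟩ := Nat.exists_eq_add_of_le' hj
    have hstep : m + (j + 1) - j = m + 1 := by omega
    rw [phi, ih (by omega), hstep]
    simp [phi]

/-- A state reaches another in time `k` exactly when the reversed system steers back. -/
theorem exists_phi_reversed_eq_iff {G : Type*} [Group G] {U : Type*} (f₀ : G ≃* G) (b : U → G)
    (k : ℕ) (x y : G) :
    (∃ u : ℕ → U, phi f₀.symm (fun u => f₀.symm (b u)⁻¹) k y u = x) ↔
      ∃ u : ℕ → U, phi f₀ b k x u = y := by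
  constructor
  · rintro ⟨u, rfl⟩
    have h := phi_reversed_phi f₀.symm (fun u => f₀.symm (b u)⁻¹) y u k k le_rfl
    simp only [← map_inv, inv_inv, MulEquiv.symm_symm, MulEquiv.apply_symm_apply,
      Nat.sub_self] at h
    exact ⟨_, h⟩
  · rintro ⟨u, rfl⟩
    have h := phi_reversed_phi f₀ b x u k k le_rfl
    rw [Nat.sub_self] at h
    exact ⟨_, h⟩

/-- for k ≥ 1, R*_k = C_k and C*_k = R_k, where the reversed system has
automorphism f₀⁻¹ and map b̂(u) = f₀⁻¹(b(u)⁻¹). -/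
theorem reversed_system_sets {G : Type*} [Group G] {U : Type*} [Zero U]
    (f₀ : G ≃* G) (b : U → G) (hb : b 0 = 1) (k : ℕ) (hk : 1 ≤ k) :
    reach f₀.symm (fun u => f₀.symm (b u)⁻¹) k 1 =
      {y : G | ∃ u : ℕ → U, phi f₀ b k y u = 1} ∧
    {y : G | ∃ u : ℕ → U, phi f₀.symm (fun u => f₀.symm (b u)⁻¹) k y u = 1} =
      reach f₀ b k 1 := by
  exact ⟨Set.ext fun y => exists_phi_reversed_eq_iff f₀ b k y 1,
    Set.ext fun y => exists_phi_reversed_eq_iff f₀ b k 1 y⟩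
end

section
/- For every k ≥ 1, the reachable set of the reversed system satisfies R*_k = f₀^{-k}((R_k)⁻¹), where (R_k)⁻¹ = {x⁻¹ : x ∈ R_k} and f₀^{-k} denotes the image under the k-th iterate of f₀⁻¹. -/
open Pointwise

theorem phi_eq_mul_iterate {G : Type*} [Group G] {U : Type*} (f₀ : G ≃* G) (b : U → G)
    (k : ℕ) (x : G) (u : ℕ → U) :
    phi f₀ b k x u = phi f₀ b k 1 u * f₀^[k] x := by
  induction k with
  | zero => simp [phi]
  | succ k ih =>
    rw [phi, phi, ih, map_mul, Function.iterate_succ_apply', mul_assoc]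

theorem phi_succ_shift {G : Type*} [Group G] {U : Type*} (f₀ : G ≃* G) (b : U → G)
    (k : ℕ) (x : G) (u : ℕ → U) :
    phi f₀ b (k + 1) x u = phi f₀ b k (b (u 0) * f₀ x) (fun i => u (i + 1)) := by
  induction k with
  | zero => rfl
  | succ k ih => rw [phi, ih, phi]

/-- The reversed system driven by the time-reversed control. -/
theorem phi_symm_eq {G : Type*} [Group G] {U : Type*} (f₀ : G ≃* G) (b : U → G)
    (k : ℕ) (u v : ℕ → U) (h : ∀ i j, i + j + 1 = k → v i = u j) :
    phi f₀.symm (fun u => f₀.symm (b u)⁻¹) k 1 v = f₀.symm^[k] (phi f₀ b k 1 u)⁻¹ := by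
  induction k generalizing u with
  | zero => simp [phi]
  | succ k ih =>
    have hinv : f₀.symm^[k] (f₀^[k] (b (u 0))⁻¹) = (b (u 0))⁻¹ :=
      Function.LeftInverse.iterate f₀.symm_apply_apply k _
    rw [phi, ih (fun i => u (i + 1)) fun i j hij => h i (j + 1) (by omega), h k 0 (by omega),
      phi_succ_shift, map_one, mul_one, phi_eq_mul_iterate f₀ b k (b (u 0)), mul_inv_rev,
      Function.iterate_succ_apply', iterate_map_mul, map_mul, ← iterate_map_inv, hinv]

/-- for k ≥ 1, R*_k = f₀^{-k}((R_k)⁻¹). -/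
theorem reversed_reach_eq {G : Type*} [Group G] {U : Type*} [Zero U]
    (f₀ : G ≃* G) (b : U → G) (hb : b 0 = 1) (k : ℕ) (hk : 1 ≤ k) :
    reach f₀.symm (fun u => f₀.symm (b u)⁻¹) k 1 =
      (⇑f₀.symm)^[k] '' (reach f₀ b k 1)⁻¹ := by
  ext y
  constructor
  · rintro ⟨v, rfl⟩
    refine ⟨(phi f₀ b k 1 fun j => v (k - 1 - j))⁻¹, ⟨_, (inv_inv _).symm⟩, ?_⟩
    refine (phi_symm_eq f₀ b k _ v fun i j hij => ?_).symm
    congr 1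
    omega
  · rintro ⟨z, ⟨u, hu⟩, rfl⟩
    refine ⟨fun i => u (k - 1 - i), ?_⟩
    rw [phi_symm_eq f₀ b k u _ fun i j hij => ?_, hu, inv_inv]
    congr 1
    omega
end

section
/- Let h be an invertible 2×2 real matrix. Then the characteristic polynomial of the ℝ-linear endomorphism of the space of 2×2 real matrices given by X ↦ h · X · h⁻¹ is divisible by (X − 1)²; equivalently, 1 is an eigenvalue of this conjugation operator of algebraic multiplicity at least 2. -/
theorem two_le_finrank_of_linearIndependent_pair {K V : Type*} [Field K] [AddCommGroup V]
    [Module K V] [FiniteDimensional K V] {S : Submodule K V} {a b : V} (ha : a ∈ S) (hb : b ∈ S)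
    (hab : LinearIndependent K ![a, b]) : 2 ≤ Module.finrank K S := by
  have hle : Submodule.span K (Set.range ![a, b]) ≤ S := by
    rw [Submodule.span_le]
    rintro _ ⟨i, rfl⟩
    fin_cases i
    exacts [ha, hb]
  simpa [finrank_span_eq_card hab] using Submodule.finrank_mono hle

theorem exists_linearIndependent_pair_commute {K : Type*} [Field K]
    (h : Matrix (Fin 2) (Fin 2) K) :
    ∃ a b : Matrix (Fin 2) (Fin 2) K,
      LinearIndependent K ![a, b] ∧ Commute h a ∧ Commute h b := by
  by_cases hd : h 0 1 = 0 ∧ h 1 0 = 0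
  · refine ⟨!![1, 0; 0, 0], !![0, 0; 0, 1], ?_, ?_, ?_⟩
    · rw [LinearIndependent.pair_iff]
      intro s t hst
      exact ⟨by simpa using congr_fun₂ hst 0 0, by simpa using congr_fun₂ hst 1 1⟩
    all_goals
      ext i j
      fin_cases i <;> fin_cases j <;> simp [Matrix.mul_apply, Fin.sum_univ_two, hd.1, hd.2]
  · refine ⟨1, h, ?_, Commute.one_right h, Commute.refl h⟩
    rw [LinearIndependent.pair_iff]
    intro s t hst
    have h01 : t = 0 ∨ h 0 1 = 0 := by simpa using congr_fun₂ hst 0 1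
    have h10 : t = 0 ∨ h 1 0 = 0 := by simpa using congr_fun₂ hst 1 0
    have ht : t = 0 := by tauto
    exact ⟨by simpa [ht] using congr_fun₂ hst 0 0, ht⟩

/-- for an invertible 2×2 real matrix h, the characteristic polynomial of
the linear endomorphism X ↦ h X h⁻¹ of M₂(ℝ) is divisible by (X − 1)²; i.e. 1 is an
eigenvalue of the conjugation operator of algebraic multiplicity at least 2. -/
theorem conj_charpoly_dvd (h : Matrix (Fin 2) (Fin 2) ℝ) (hh : IsUnit h) :
    (Polynomial.X - 1) ^ 2 ∣
      LinearMap.charpoly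
        ((LinearMap.mulLeft ℝ h).comp (LinearMap.mulRight ℝ h⁻¹)) := by
  set φ : Module.End ℝ (Matrix (Fin 2) (Fin 2) ℝ) :=
    (LinearMap.mulLeft ℝ h).comp (LinearMap.mulRight ℝ h⁻¹) with hφ
  have hmem : ∀ a, Commute h a → a ∈ φ.eigenspace 1 := by
    intro a ha
    rw [Module.End.mem_eigenspace_iff, one_smul, hφ, LinearMap.comp_apply,
      LinearMap.mulRight_apply, LinearMap.mulLeft_apply, ← mul_assoc, ha.eq,
      Matrix.mul_nonsing_inv_cancel_right _ _ ((Matrix.isUnit_iff_isUnit_det h).1 hh)]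
  obtain ⟨a, b, hab, ha, hb⟩ := exists_linearIndependent_pair_commute h
  have hmult : 2 ≤ φ.charpoly.rootMultiplicity 1 :=
    (two_le_finrank_of_linearIndependent_pair (hmem a ha) (hmem b hb) hab).trans
      (LinearMap.finrank_eigenspace_le φ 1)
  simpa using (Polynomial.le_rootMultiplicity_iff φ.charpoly_monic.ne_zero).1 hmult
end
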